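/- The number of external lines to the hyperbolic quadric is exactly 56; that is, there are exactly 56 three-element subsets {a, b, c} of (Fin 6 → ZMod 2) such that a + b + c = 0 and each of a, b, c is nonzero with Q-value 1. -/

import Mathlib

/-- The hyperbolic quadratic form on GF(2)^6. -/
def Q (v : Fin 6 → ZMod 2) : ZMod 2 := v 0 * v 1 + v 2 * v 3 + v 4 * v 5

/-- Ordered pairs of points spanning an external line. -/
def externalPairs : Finset ((Fin 6 → ZMod 2) × (Fin 6 → ZMod 2)) :=
  Finset.univ.filter (fun p => Q p.1 = 1 ∧ Q p.2 = 1 ∧ Q (p.1 + p.2) = 1)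

theorem mem_externalPairs (a b : Fin 6 → ZMod 2) :
    (a, b) ∈ externalPairs ↔ Q a = 1 ∧ Q b = 1 ∧ Q (a + b) = 1 := by
  simp only [externalPairs, Finset.mem_filter, Finset.mem_univ, true_and]

theorem externalPairs_card : externalPairs.card = 336 := by
  decide +kernel

theorem vec_add_self (a : Fin 6 → ZMod 2) : a + a = 0 := by
  ext i
  exact CharTwo.add_self_eq_zero (a i)

theorem Q_zero : Q 0 = 0 := by simp [Q]

theorem ne_zero_of_Q {a : Fin 6 → ZMod 2} (h : Q a = 1) : a ≠ 0 := by
  rintro rfl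
  rw [Q_zero] at h
  exact zero_ne_one h

/-- Two points of an external line determine the third one. -/
theorem third_point {a b c : Fin 6 → ZMod 2} (h : a + (b + c) = 0) : c = a + b := by
  have h1 : (a + b) + c = (a + b) + (a + b) := by
    rw [vec_add_self, add_assoc, h]
  exact add_left_cancel h1

/-- The line through two points. -/
def lineOf (p : (Fin 6 → ZMod 2) × (Fin 6 → ZMod 2)) : Finset (Fin 6 → ZMod 2) :=
  {p.1, p.2, p.1 + p.2}

/-- Distinctness of the three points of the line spanned by an external pair. -/
theorem distinct_points {a b : Fin 6 → ZMod 2} (ha : Q a = 1) (hb : Q b = 1)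
    (hab : Q (a + b) = 1) : a ≠ b ∧ a ≠ a + b ∧ b ≠ a + b := by
  refine ⟨?_, ?_, ?_⟩
  · rintro rfl
    exact ne_zero_of_Q hab (vec_add_self a)
  · intro h
    exact ne_zero_of_Q hb (left_eq_add.mp h)
  · intro h
    exact ne_zero_of_Q ha (right_eq_add.mp h)

/-- In a three-point set with zero sum, any two distinct points span the set. -/
theorem lineOf_eq {L : Finset (Fin 6 → ZMod 2)} (hc : L.card = 3) (hs : ∑ v ∈ L, v = 0)
    {a b : Fin 6 → ZMod 2} (ha : a ∈ L) (hb : b ∈ L) (hab : a ≠ b) : lineOf (a, b) = L := by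
  have hb' : b ∈ L.erase a := Finset.mem_erase.mpr ⟨hab.symm, hb⟩
  have h1 : ((L.erase a).erase b).card = 1 := by
    rw [Finset.card_erase_of_mem hb', Finset.card_erase_of_mem ha, hc]
  obtain ⟨c, hcc⟩ := Finset.card_eq_one.mp h1
  rw [← Finset.add_sum_erase L _ ha, ← Finset.add_sum_erase _ _ hb', hcc,
    Finset.sum_singleton] at hs
  have h3 := third_point hs
  subst h3
  rw [← Finset.insert_erase ha, ← Finset.insert_erase hb', hcc]
  rfl

/-- Double counting of ordered pairs of points on external lines. -/
theorem card_lines_of_pairs (P : Finset ((Fin 6 → ZMod 2) × (Fin 6 → ZMod 2)))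
    (hP : ∀ a b, (a, b) ∈ P ↔ Q a = 1 ∧ Q b = 1 ∧ Q (a + b) = 1) (hPc : P.card = 336)
    (F : Finset (Finset (Fin 6 → ZMod 2)))
    (hF : ∀ L, L ∈ F ↔ L.card = 3 ∧ (∑ v ∈ L, v) = 0 ∧ ∀ v ∈ L, v ≠ 0 ∧ Q v = 1) :
    F.card = 56 := by
  have hmaps : ∀ p ∈ P, lineOf p ∈ F := by
    rintro ⟨a, b⟩ hp
    rw [hP] at hp
    obtain ⟨ha, hb, hab⟩ := hp
    obtain ⟨h1, h2, h3⟩ := distinct_points ha hb hab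
    refine (hF _).mpr ⟨?_, ?_, ?_⟩
    · exact Finset.card_eq_three.mpr ⟨a, b, a + b, h1, h2, h3, rfl⟩
    · have hn1 : a ∉ ({b, a + b} : Finset (Fin 6 → ZMod 2)) := by
        rw [Finset.mem_insert, Finset.mem_singleton]
        exact not_or.mpr ⟨h1, h2⟩
      change ∑ v ∈ ({a, b, a + b} : Finset (Fin 6 → ZMod 2)), v = 0
      rw [Finset.sum_insert hn1, Finset.sum_pair h3, ← add_assoc, vec_add_self]
    · intro v hv
      have hQ : Q v = 1 := by
        change v ∈ ({a, b, a + b} : Finset (Fin 6 → ZMod 2)) at hv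
        rw [Finset.mem_insert, Finset.mem_insert, Finset.mem_singleton] at hv
        rcases hv with rfl | rfl | rfl
        · exact ha
        · exact hb
        · exact hab
      exact ⟨ne_zero_of_Q hQ, hQ⟩
  have hfib : ∀ L ∈ F, (P.filter (fun p => lineOf p = L)).card = 6 := by
    intro L hL
    obtain ⟨hc, hs, hq⟩ := (hF L).mp hL
    have heq : P.filter (fun p => lineOf p = L) = L.offDiag := by
      ext ⟨a, b⟩
      rw [Finset.mem_filter, Finset.mem_offDiag]
      constructor
      · rintro ⟨hp, rfl⟩
        rw [hP] at hp
        obtain ⟨ha, hb, hab⟩ := hp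
        exact ⟨by simp [lineOf], by simp [lineOf], (distinct_points ha hb hab).1⟩
      · rintro ⟨ha, hb, hab⟩
        have hl := lineOf_eq hc hs ha hb hab
        have hm : a + b ∈ L := by
          rw [← hl]
          simp [lineOf]
        refine And.intro ?_ hl
        rw [hP]
        exact ⟨(hq a ha).2, (hq b hb).2, (hq _ hm).2⟩
    rw [heq, Finset.offDiag_card, hc]
  have hcount := Finset.card_eq_sum_card_fiberwise hmaps
  rw [Finset.sum_congr rfl hfib, Finset.sum_const, hPc, smul_eq_mul] at hcount
  omega

/-- There are exactly 56 lines of PG(5,2) external to the hyperbolic quadric Q⁺(5,2):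
56 three-element sets of nonzero vectors, each of Q-value 1, summing to zero. -/
theorem external_lines_card :
    (Finset.univ.filter (fun L : Finset (Fin 6 → ZMod 2) =>
      L.card = 3 ∧ (∑ v ∈ L, v) = 0 ∧ ∀ v ∈ L, v ≠ 0 ∧ Q v = 1)).card = 56 := by
  refine card_lines_of_pairs externalPairs mem_externalPairs externalPairs_card _ ?_
  intro L
  simp only [Finset.mem_filter, Finset.mem_univ, true_and]
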